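/- The function u_R : {x ∈ ℝ^N : |x| > R} → ℝ defined by u_R(x) := v_R(|x|) is infinitely differentiable and strictly positive, and it solves the minimal surface equation div(∇u_R/√(1 + |∇u_R|²)) = 0 at every point x with |x| > R, where div denotes the sum of the partial derivatives of the components of the vector field x ↦ ∇u_R(x)/√(1 + |∇u_R(x)|²). -/

import Mathlib

open MeasureTheory Filter Set

section Radial

variable {E : Type*} [NormedAddCommGroup E] [InnerProductSpace ℝ E]

theorem hasFDerivAt_norm_of_ne_zero {x : E} (hx : x ≠ 0) :
    HasFDerivAt (fun y : E => ‖y‖) (‖x‖⁻¹ • innerSL ℝ x) x := by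
  have hn : ‖x‖ ≠ 0 := norm_ne_zero_iff.mpr hx
  have h := (hasStrictFDerivAt_norm_sq x).hasFDerivAt.sqrt (pow_ne_zero 2 hn)
  simp only [Real.sqrt_sq (norm_nonneg _)] at h
  convert! h using 1
  ext y
  simp
  field_simp

theorem HasDerivAt.hasGradientAt_comp_norm [CompleteSpace E] {f : ℝ → ℝ} {f' : ℝ} {x : E}
    (hx : x ≠ 0) (hf : HasDerivAt f f' ‖x‖) :
    HasGradientAt (fun y : E => f ‖y‖) ((f' / ‖x‖) • x) x := by
  rw [hasGradientAt_iff_hasFDerivAt]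
  convert! hf.comp_hasFDerivAt x (hasFDerivAt_norm_of_ne_zero hx) using 1
  ext y
  simp [div_eq_mul_inv, mul_assoc]

theorem sum_fderiv_norm_rpow_mul_coord {N : ℕ} (p : ℝ) {x : EuclideanSpace ℝ (Fin N)}
    (hx : x ≠ 0) :
    ∑ i, fderiv ℝ (fun y : EuclideanSpace ℝ (Fin N) => ‖y‖ ^ p * y i) x
      (EuclideanSpace.single i 1) = (p + N) * ‖x‖ ^ p := by
  have hn : 0 < ‖x‖ := norm_pos_iff.mpr hx
  have key : ∀ i, fderiv ℝ (fun y : EuclideanSpace ℝ (Fin N) => ‖y‖ ^ p * y i) x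
      (EuclideanSpace.single i 1) = ‖x‖ ^ p + p * ‖x‖ ^ (p - 1) * ‖x‖⁻¹ * ‖x i‖ ^ 2 := by
    intro i
    have h1 := (Real.hasDerivAt_rpow_const (x := ‖x‖) (p := p) (Or.inl hn.ne')).comp_hasFDerivAt x
      (hasFDerivAt_norm_of_ne_zero hx)
    have h2 : HasFDerivAt (fun y : EuclideanSpace ℝ (Fin N) => y i)
        (EuclideanSpace.proj i : EuclideanSpace ℝ (Fin N) →L[ℝ] ℝ) x :=
      (EuclideanSpace.proj i : EuclideanSpace ℝ (Fin N) →L[ℝ] ℝ).hasFDerivAt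
    have h3 : HasFDerivAt (fun y : EuclideanSpace ℝ (Fin N) => ‖y‖ ^ p * y i) _ x := h1.mul h2
    rw [h3.fderiv]
    simp [EuclideanSpace.inner_single_right]
    ring
  rw [Finset.sum_congr rfl fun i _ => key i, Finset.sum_add_distrib, ← Finset.mul_sum,
    ← EuclideanSpace.norm_sq_eq, Real.rpow_sub_one hn.ne']
  simp
  field_simp
  ring

end Radial

theorem hasDerivAt_integral_Ioi {f : ℝ → ℝ} {R : ℝ} (hf : ContinuousOn f (Ioi R))
    (hint : ∀ r, R < r → IntegrableOn f (Ioi r)) {r : ℝ} (hr : R < r) :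
    HasDerivAt (fun s => ∫ t in Ioi s, f t) (-f r) r := by
  obtain ⟨a, hRa, har⟩ := exists_between hr
  have h1 : HasDerivAt (fun s => ∫ t in a..s, f t) (f r) r := by
    refine intervalIntegral.integral_hasDerivAt_right ?_
      (hf.stronglyMeasurableAtFilter isOpen_Ioi r hr) (hf.continuousAt (Ioi_mem_nhds hr))
    exact (intervalIntegrable_iff_integrableOn_Ioc_of_le har.le).mpr
      ((hint a hRa).mono_set Ioc_subset_Ioi_self)
  refine (h1.const_sub (∫ t in Ioi a, f t)).congr_of_eventuallyEq ?_
  filter_upwards [Ioi_mem_nhds har] with s hs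
  rw [← intervalIntegral.integral_Ioi_sub_Ioi (hint a hRa) (le_of_lt hs)]
  ring

theorem contDiffOn_integral_Ioi {f : ℝ → ℝ} {R : ℝ} (hf : ContDiffOn ℝ (⊤ : ℕ∞) f (Ioi R))
    (hint : ∀ r, R < r → IntegrableOn f (Ioi r)) :
    ContDiffOn ℝ (⊤ : ℕ∞) (fun s => ∫ t in Ioi s, f t) (Ioi R) := by
  have hd := fun r (hr : r ∈ Ioi R) => hasDerivAt_integral_Ioi hf.continuousOn hint hr
  rw [contDiffOn_infty_iff_deriv_of_isOpen isOpen_Ioi]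
  exact ⟨fun r hr => (hd r hr).differentiableAt.differentiableWithinAt,
    hf.neg.congr fun r hr => (hd r hr).deriv⟩

section Profile

variable {R p q : ℝ}

theorem rpow_sub_rpow_pos_of_neg (hR : 0 < R) (hq : q < 0) {ρ : ℝ} (hρ : R < ρ) :
    0 < R ^ q - ρ ^ q :=
  sub_pos.mpr (Real.rpow_lt_rpow_of_neg hR hρ hq)

theorem contDiffOn_rpow_div_sqrt (hR : 0 < R) (hq : q < 0) :
    ContDiffOn ℝ (⊤ : ℕ∞) (fun ρ : ℝ => ρ ^ p / Real.sqrt (R ^ q - ρ ^ q)) (Ioi R) := by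
  intro ρ hρ
  have hpos : ρ ≠ 0 := (hR.trans hρ).ne'
  have hs := rpow_sub_rpow_pos_of_neg hR hq hρ
  exact ((contDiffAt_id.rpow_const_of_ne hpos).div
    ((contDiffAt_const.sub (contDiffAt_id.rpow_const_of_ne hpos)).sqrt hs.ne')
    (Real.sqrt_ne_zero'.mpr hs)).contDiffWithinAt

theorem integrableOn_rpow_div_sqrt (hR : 0 < R) (hq : q < 0) (hp : p < -1) {r : ℝ} (hr : R < r) :
    IntegrableOn (fun ρ : ℝ => ρ ^ p / Real.sqrt (R ^ q - ρ ^ q)) (Ioi r) := by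
  have hr0 : 0 < r := hR.trans hr
  refine ((integrableOn_Ioi_rpow_of_lt hp hr0).div_const (Real.sqrt (R ^ q - r ^ q))).mono'
    (((contDiffOn_rpow_div_sqrt hR hq).continuousOn.mono
      (Ioi_subset_Ioi hr.le)).aestronglyMeasurable measurableSet_Ioi) ?_
  filter_upwards [ae_restrict_mem measurableSet_Ioi] with ρ hρ
  have hρ0 : 0 < ρ := hr0.trans hρ
  have hs := rpow_sub_rpow_pos_of_neg hR hq hr
  have hle : ρ ^ q ≤ r ^ q := (Real.rpow_lt_rpow_of_neg hr0 hρ hq).le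
  rw [Real.norm_of_nonneg (by positivity)]
  gcongr

theorem integral_Ioi_rpow_div_sqrt_pos (hR : 0 < R) (hq : q < 0) (hp : p < -1) {r : ℝ}
    (hr : R < r) : 0 < ∫ ρ in Ioi r, ρ ^ p / Real.sqrt (R ^ q - ρ ^ q) := by
  have hpos : ∀ ρ ∈ Ioi r, 0 < ρ ^ p / Real.sqrt (R ^ q - ρ ^ q) := fun ρ hρ =>
    div_pos (Real.rpow_pos_of_pos (hR.trans (hr.trans hρ)) p)
      (Real.sqrt_pos.mpr (rpow_sub_rpow_pos_of_neg hR hq (hr.trans hρ)))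
  rw [setIntegral_pos_iff_support_of_nonneg_ae
    ((ae_restrict_mem measurableSet_Ioi).mono fun ρ hρ => (hpos ρ hρ).le)
    (integrableOn_rpow_div_sqrt hR hq hp hr),
    inter_eq_right.mpr fun ρ hρ => Function.mem_support.mpr (hpos ρ hρ).ne']
  simp

/-- First integral of the radial minimal surface equation: the slope
`F = ρ ^ p / √(R ^ (2 * p) - ρ ^ (2 * p))` satisfies `F / √(1 + F ^ 2) = ρ ^ p / √(R ^ (2 * p))`. -/
theorem rpow_div_sqrt_div_sqrt_one_add_sq (hR : 0 < R) (hp : p < 0) {ρ : ℝ} (hρ : R < ρ) :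
    ρ ^ p / Real.sqrt (R ^ (2 * p) - ρ ^ (2 * p)) /
      Real.sqrt (1 + (ρ ^ p / Real.sqrt (R ^ (2 * p) - ρ ^ (2 * p))) ^ 2) =
    ρ ^ p / Real.sqrt (R ^ (2 * p)) := by
  have hs := rpow_sub_rpow_pos_of_neg hR (by linarith : 2 * p < 0) hρ
  have hsq : (ρ ^ p) ^ 2 = ρ ^ (2 * p) := by
    rw [mul_comm, Real.rpow_mul (hR.trans hρ).le, Real.rpow_two]
  have h1 : 1 + (ρ ^ p / Real.sqrt (R ^ (2 * p) - ρ ^ (2 * p))) ^ 2 =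
      R ^ (2 * p) / (R ^ (2 * p) - ρ ^ (2 * p)) := by
    rw [div_pow, Real.sq_sqrt hs.le, hsq]
    field_simp
    ring
  have hs' := Real.sqrt_pos.mpr hs
  have hR' : 0 < Real.sqrt (R ^ (2 * p)) := Real.sqrt_pos.mpr (Real.rpow_pos_of_pos hR _)
  rw [h1, Real.sqrt_div (Real.rpow_pos_of_pos hR _).le]
  field_simp

end Profile

theorem stmt_1 (N : ℕ) (hN : 3 ≤ N) (R : ℝ) (hR : 0 < R)
    (F : ℝ → ℝ)
    (hF : ∀ ρ : ℝ,
      F ρ = ρ ^ ((1 : ℝ) - N) / Real.sqrt (R ^ ((2 : ℝ) - 2 * N) - ρ ^ ((2 : ℝ) - 2 * N)))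
    (v : ℝ → ℝ) (hv : ∀ r : ℝ, v r = ∫ ρ in Ioi r, F ρ)
    (u : EuclideanSpace ℝ (Fin N) → ℝ) (hu : ∀ x, u x = v ‖x‖) :
    (∀ x : EuclideanSpace ℝ (Fin N), R < ‖x‖ → 0 < u x) ∧
    ContDiffOn ℝ (⊤ : ℕ∞) u {x : EuclideanSpace ℝ (Fin N) | R < ‖x‖} ∧
    (∀ x : EuclideanSpace ℝ (Fin N), R < ‖x‖ →
      ∑ i, fderiv ℝ
          (fun y => gradient u y i / Real.sqrt (1 + ‖gradient u y‖ ^ 2)) x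
          (EuclideanSpace.single i 1) = 0) := by
  have hN' : (3 : ℝ) ≤ N := by exact_mod_cast hN
  have hp : (1 : ℝ) - N < -1 := by linarith
  have hp0 : (1 : ℝ) - N < 0 := by linarith
  have hq : (2 : ℝ) - 2 * N < 0 := by linarith
  obtain rfl : v = _ := funext hv
  have hsm : ContDiffOn ℝ (⊤ : ℕ∞) F (Ioi R) :=
    (contDiffOn_rpow_div_sqrt hR hq).congr fun ρ _ => hF ρ
  have hint : ∀ r, R < r → IntegrableOn F (Ioi r) := fun r hr => by
    rw [funext hF]
    exact integrableOn_rpow_div_sqrt hR hq hp hr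
  have hne : ∀ x : EuclideanSpace ℝ (Fin N), R < ‖x‖ → x ≠ 0 := fun x hx =>
    norm_pos_iff.mp (hR.trans hx)
  refine ⟨fun x hx => ?_, fun x hx => ?_, fun x hx => ?_⟩
  · rw [hu, funext hF]
    exact integral_Ioi_rpow_div_sqrt_pos hR hq hp hx
  · rw [funext hu]
    exact (((contDiffOn_integral_Ioi hsm hint).contDiffAt (Ioi_mem_nhds hx)).comp x
      (contDiffAt_norm ℝ (hne x hx))).contDiffWithinAt
  · set c : ℝ := -(Real.sqrt (R ^ ((2 : ℝ) - 2 * N)))⁻¹ with hc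
    have hfield : ∀ i : Fin N, ∀ y : EuclideanSpace ℝ (Fin N), R < ‖y‖ →
        gradient u y i / Real.sqrt (1 + ‖gradient u y‖ ^ 2) =
          c * (‖y‖ ^ (-(N : ℝ)) * y i) := by
      intro i y hy
      have hy0 : 0 < ‖y‖ := hR.trans hy
      have hflux := rpow_div_sqrt_div_sqrt_one_add_sq hR hp0 hy
      rw [show (2 : ℝ) * (1 - N) = 2 - 2 * N by ring, ← hF] at hflux
      rw [funext hu, ((hasDerivAt_integral_Ioi hsm.continuousOn hint hy).hasGradientAt_comp_norm
        (hne y hy)).gradient]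
      have hnorm : ‖(-F ‖y‖ / ‖y‖) • y‖ ^ 2 = F ‖y‖ ^ 2 := by
        rw [norm_smul, mul_pow, Real.norm_eq_abs, sq_abs]
        field_simp
      rw [hnorm, PiLp.smul_apply, smul_eq_mul]
      calc -F ‖y‖ / ‖y‖ * y i / Real.sqrt (1 + F ‖y‖ ^ 2)
          = -(F ‖y‖ / Real.sqrt (1 + F ‖y‖ ^ 2)) / ‖y‖ * y i := by ring
        _ = c * (‖y‖ ^ (-(N : ℝ)) * y i) := by
          rw [hflux, sub_eq_add_neg, Real.rpow_add hy0, Real.rpow_one, hc]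
          field_simp
    have hev : ∀ᶠ y : EuclideanSpace ℝ (Fin N) in nhds x, R < ‖y‖ :=
      (isOpen_lt continuous_const continuous_norm).mem_nhds hx
    have hfd : ∀ i : Fin N,
        fderiv ℝ (fun y => gradient u y i / Real.sqrt (1 + ‖gradient u y‖ ^ 2)) x
          (EuclideanSpace.single i 1) =
        c * fderiv ℝ (fun y : EuclideanSpace ℝ (Fin N) => ‖y‖ ^ (-(N : ℝ)) * y i) x
          (EuclideanSpace.single i 1) := fun i => by
      rw [EventuallyEq.fderiv_eq (hev.mono (hfield i))]
      exact DFunLike.congr_fun (congrFun (fderiv_const_smul_field (𝕜 := ℝ)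
        (f := fun y : EuclideanSpace ℝ (Fin N) => ‖y‖ ^ (-(N : ℝ)) * y i) c) x) _
    rw [Finset.sum_congr rfl fun i _ => hfd i, ← Finset.mul_sum,
      sum_fderiv_norm_rpow_mul_coord _ (hne x hx)]
    simp
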